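/- arXiv:2512.08177 — 2 statements merged into one kernel-verified Lean document; each statement's English description precedes it below -/
import Mathlib

section
/- If a mechanism M = (q, u) is in the short list, then q(θ) ≥ q_ℓ for all θ ∈ Θ, and q(θ̄) = q_ℓ. -/
open MeasureTheory Set

noncomputable section

/-- The base environment: type space `Θ = [θl, θu]`, capacity `qbar`, lowest inverse
demand `Pl = P̲` (decreasing and continuous on `[0, qbar]` with `Pl 0 > θu`) and the
induced lowest demand `Dl = D̲`, with `Dl θl < qbar`. -/
structure Env where
  θl : ℝ
  θu : ℝ
  qbar : ℝ
  Pl : ℝ → ℝ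
  Dl : ℝ → ℝ
  θl_pos : 0 < θl
  θlu : θl < θu
  qbar_pos : 0 < qbar
  Pl_anti : StrictAntiOn Pl (Icc 0 qbar)
  Pl_cont : ContinuousOn Pl (Icc 0 qbar)
  Pl0 : θu < Pl 0
  Dl_inv : ∀ p, Pl qbar ≤ p → p ≤ Pl 0 → Dl p ∈ Icc (0:ℝ) qbar ∧ Pl (Dl p) = p
  Dl_high : ∀ p, Pl 0 < p → Dl p = 0
  Dl_low : ∀ p, p < Pl qbar → Dl p = qbar
  Dl_lt : Dl θl < qbar

namespace Env

/-- The type space `Θ = [θl, θu]`. -/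
def Θ (E : Env) : Set ℝ := Icc E.θl E.θu

/-- The lowest gross value function `V̲ (x) = ∫_0^x P̲`. -/
def Vl (E : Env) (x : ℝ) : ℝ := ∫ s in (0:ℝ)..x, E.Pl s

/-- `q_ℓ = D̲(θu)`: the efficient quantity at the lowest demand and highest cost. -/
def ql (E : Env) : ℝ := E.Dl E.θu

/-- `G* = V̲(q_ℓ) − θu · q_ℓ`: the maximal attainable guarantee. -/
def Gstar (E : Env) : ℝ := E.Vl E.ql - E.θu * E.ql

/-- A feasible quantity schedule: weakly decreasing on `Θ`, valued in `[0, qbar]`. -/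
def IsSchedule (E : Env) (q : ℝ → ℝ) : Prop :=
  AntitoneOn q E.Θ ∧ ∀ θ ∈ E.Θ, q θ ∈ Icc (0:ℝ) E.qbar

/-- `W̲(θ, q) = V̲(q(θ)) − θ q(θ) − ∫_θ^{θu} q`: ex-post welfare at the lowest demand
with zero rent for the highest type. -/
def Wl (E : Env) (q : ℝ → ℝ) (θ : ℝ) : ℝ :=
  E.Vl (q θ) - θ * q θ - ∫ y in θ..E.θu, q y

/-- An IC and IR (direct) quantity mechanism `(q, u)`. -/
def IsMech (E : Env) (q u : ℝ → ℝ) : Prop :=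
  E.IsSchedule q ∧ 0 ≤ u E.θu ∧
    ∀ θ ∈ E.Θ, u θ = u E.θu + ∫ y in θ..E.θu, q y

/-- The set `𝒱` of admissible gross value functions: integrals of decreasing continuous
inverse demands dominating `P̲` pointwise. -/
def IsValue (E : Env) (V : ℝ → ℝ) : Prop :=
  ∃ P : ℝ → ℝ, StrictAntiOn P (Icc 0 E.qbar) ∧ ContinuousOn P (Icc 0 E.qbar) ∧
    (∀ s ∈ Icc (0:ℝ) E.qbar, E.Pl s ≤ P s) ∧ ∀ x, V x = ∫ s in (0:ℝ)..x, P s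

/-- A Borel probability measure supported in `Θ` (the measure of a cdf `F ∈ 𝒻`). -/
def IsTech (E : Env) (μ : Measure ℝ) : Prop :=
  IsProbabilityMeasure μ ∧ μ (E.Θᶜ) = 0

/-- Ex-ante welfare `W(M; V, F)` of the mechanism `(q, u)` under value `V` and
cost technology `μ`. -/
def W (E : Env) (q u V : ℝ → ℝ) (μ : Measure ℝ) : ℝ :=
  ∫ θ, (V (q θ) - θ * q θ - u θ) ∂μ

/-- The welfare guarantee `G(M) = inf_{V ∈ 𝒱, F ∈ 𝒻} W(M; V, F)`. -/
def G (E : Env) (q u : ℝ → ℝ) : ℝ :=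
  sInf {w : ℝ | ∃ (V : ℝ → ℝ) (μ : Measure ℝ),
    E.IsValue V ∧ E.IsTech μ ∧ w = E.W q u V μ}

/-- The short list: IC and IR mechanisms with the highest guarantee. -/
def ShortList (E : Env) (q u : ℝ → ℝ) : Prop :=
  E.IsMech q u ∧ ∀ q' u' : ℝ → ℝ, E.IsMech q' u' → E.G q' u' ≤ E.G q u

/-- Feasibility in the program (ROPT): a schedule satisfying all robustness
constraints `W̲(θ, q) ≥ G*`. -/
def FeasibleROPT (E : Env) (q : ℝ → ℝ) : Prop :=
  E.IsSchedule q ∧ ∀ θ ∈ E.Θ, E.Gstar ≤ E.Wl q θ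

end Env

/-- A demand `D ∈ 𝒟`, bundled with the inverse demand `P` that induces it:
`P` decreasing and continuous on `[0, qbar]`, `P ≥ P̲` pointwise, `P 0 > θu`. -/
structure Demand (E : Env) where
  P : ℝ → ℝ
  D : ℝ → ℝ
  P_anti : StrictAntiOn P (Icc 0 E.qbar)
  P_cont : ContinuousOn P (Icc 0 E.qbar)
  P_ge : ∀ s ∈ Icc (0:ℝ) E.qbar, E.Pl s ≤ P s
  P0 : E.θu < P 0
  D_inv : ∀ p, P E.qbar ≤ p → p ≤ P 0 → D p ∈ Icc (0:ℝ) E.qbar ∧ P (D p) = p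
  D_high : ∀ p, P 0 < p → D p = 0
  D_low : ∀ p, p < P E.qbar → D p = E.qbar
  D_lt : D E.θl < E.qbar

namespace Demand

/-- The gross value function `V_D(x) = ∫_0^x P` induced by a demand `D ∈ 𝒟`. -/
def V {E : Env} (D : Demand E) (x : ℝ) : ℝ := ∫ s in (0:ℝ)..x, D.P s

end Demand

namespace Env

/-- The lowest demand `D̲` as an element of `𝒟`. -/
def DlDemand (E : Env) : Demand E where
  P := E.Pl
  D := E.Dl
  P_anti := E.Pl_anti
  P_cont := E.Pl_cont
  P_ge := fun _ _ => le_refl _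
  P0 := E.Pl0
  D_inv := E.Dl_inv
  D_high := E.Dl_high
  D_low := E.Dl_low
  D_lt := E.Dl_lt

/-- A price regulation `(p, t)`: nonnegative prices and transfers. -/
def IsPriceReg (E : Env) (p : ℝ → ℝ) (t : ℝ → Demand E → ℝ) : Prop :=
  (∀ θ ∈ E.Θ, 0 ≤ p θ) ∧ ∀ θ ∈ E.Θ, ∀ D : Demand E, 0 ≤ t θ D

/-- The rent `ũ(θ, D) = t(θ, D) − θ · D(p(θ))` of the monopolist. -/
def rent (E : Env) (p : ℝ → ℝ) (t : ℝ → Demand E → ℝ) (θ : ℝ) (D : Demand E) : ℝ :=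
  t θ D - θ * D.D (p θ)

/-- Ex-post incentive compatibility of a price regulation. -/
def EPIC (E : Env) (p : ℝ → ℝ) (t : ℝ → Demand E → ℝ) : Prop :=
  ∀ θ ∈ E.Θ, ∀ θ' ∈ E.Θ, ∀ D : Demand E,
    t θ' D - θ * D.D (p θ') ≤ E.rent p t θ D

/-- Ex-post individual rationality of a price regulation. -/
def EPIR (E : Env) (p : ℝ → ℝ) (t : ℝ → Demand E → ℝ) : Prop :=
  ∀ θ ∈ E.Θ, ∀ D : Demand E, 0 ≤ E.rent p t θ D

/-- Ex-post welfare `w̃(θ; D) = V_D(D(p(θ))) − θ·D(p(θ)) − ũ(θ, D)`. -/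
def wt (E : Env) (p : ℝ → ℝ) (t : ℝ → Demand E → ℝ) (θ : ℝ) (D : Demand E) : ℝ :=
  D.V (D.D (p θ)) - θ * D.D (p θ) - E.rent p t θ D

/-- Ex-ante welfare `W̃((p,t); D, F)` of a price regulation. -/
def Wt (E : Env) (p : ℝ → ℝ) (t : ℝ → Demand E → ℝ) (D : Demand E) (μ : Measure ℝ) : ℝ :=
  ∫ θ, E.wt p t θ D ∂μ

/-- The welfare guarantee `G̃((p,t)) = inf_{D ∈ 𝒟, F ∈ 𝒻} W̃((p,t); D, F)`. -/
def Gt (E : Env) (p : ℝ → ℝ) (t : ℝ → Demand E → ℝ) : ℝ :=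
  sInf {w : ℝ | ∃ (D : Demand E) (μ : Measure ℝ), E.IsTech μ ∧ w = E.Wt p t D μ}

/-- An EPIC and EPIR price regulation. -/
def IsAdmissiblePR (E : Env) (p : ℝ → ℝ) (t : ℝ → Demand E → ℝ) : Prop :=
  E.IsPriceReg p t ∧ E.EPIC p t ∧ E.EPIR p t

/-- The price short list: EPIC and EPIR price regulations with the highest guarantee. -/
def PriceShortList (E : Env) (p : ℝ → ℝ) (t : ℝ → Demand E → ℝ) : Prop :=
  E.IsAdmissiblePR p t ∧
    ∀ (p' : ℝ → ℝ) (t' : ℝ → Demand E → ℝ), E.IsAdmissiblePR p' t' → E.Gt p' t' ≤ E.Gt p t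

end Env

/-- The conjectured model: a regular cdf `F*` with density `f*` on `Θ`, and a
conjectured inverse demand `P*` (with induced demand `D*`) dominating `P̲`. -/
structure Model (E : Env) where
  Fstar : ℝ → ℝ
  fstar : ℝ → ℝ
  Pstar : ℝ → ℝ
  Dstar : ℝ → ℝ
  fstar_pos : ∀ θ ∈ E.Θ, 0 < fstar θ
  Fstar_ac : ∀ θ ∈ E.Θ, Fstar θ = ∫ y in E.θl..θ, fstar y
  Fstar_l : Fstar E.θl = 0
  Fstar_u : Fstar E.θu = 1
  zstar_cont : ContinuousOn (fun θ => θ + Fstar θ / fstar θ) E.Θ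
  zstar_mono : StrictMonoOn (fun θ => θ + Fstar θ / fstar θ) E.Θ
  Pstar_anti : StrictAntiOn Pstar (Icc 0 E.qbar)
  Pstar_cont : ContinuousOn Pstar (Icc 0 E.qbar)
  Pstar_ge : ∀ s ∈ Icc (0:ℝ) E.qbar, E.Pl s ≤ Pstar s
  Pstar0 : E.θu < Pstar 0
  Dstar_inv : ∀ p, Pstar E.qbar ≤ p → p ≤ Pstar 0 →
    Dstar p ∈ Icc (0:ℝ) E.qbar ∧ Pstar (Dstar p) = p
  Dstar_high : ∀ p, Pstar 0 < p → Dstar p = 0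
  Dstar_low : ∀ p, p < Pstar E.qbar → Dstar p = E.qbar
  Dstar_lt : Dstar E.θl < E.qbar

namespace Model

variable {E : Env} (Mo : Model E)

/-- The virtual cost `z*(θ) = θ + F*(θ)/f*(θ)`. -/
def zstar (θ : ℝ) : ℝ := θ + Mo.Fstar θ / Mo.fstar θ

/-- The conjectured gross value function `V*(x) = ∫_0^x P*`. -/
def Vstar (x : ℝ) : ℝ := ∫ s in (0:ℝ)..x, Mo.Pstar s

/-- The Baron–Myerson schedule `q^BM(θ) = D*(z*(θ))`. -/
def qBM (θ : ℝ) : ℝ := Mo.Dstar (Mo.zstar θ)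

/-- The Baron–Myerson-with-quantity-floor schedule `q*(θ) = max{q^BM(θ), q_ℓ}`. -/
def qstar (θ : ℝ) : ℝ := max (Mo.qBM θ) E.ql

/-- The objective of (ROPT): expected virtual surplus under the conjectured model. -/
def J (q : ℝ → ℝ) : ℝ :=
  ∫ θ in E.θl..E.θu, (Mo.Vstar (q θ) - Mo.zstar θ * q θ) * Mo.fstar θ

/-- `q` solves the program (ROPT). -/
def SolvesROPT (q : ℝ → ℝ) : Prop :=
  E.FeasibleROPT q ∧ ∀ q' : ℝ → ℝ, E.FeasibleROPT q' → Mo.J q' ≤ Mo.J q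

/-- `θ*`: the unique solution of `q^BM(θ*) = q_ℓ` in `Θ` when `q^BM(θu) < q_ℓ`;
otherwise `θ* = θu`. -/
def IsThetaStar (θs : ℝ) : Prop :=
  (Mo.qBM E.θu < E.ql ∧ θs ∈ E.Θ ∧ Mo.qBM θs = E.ql) ∨
    (E.ql ≤ Mo.qBM E.θu ∧ θs = E.θu)

/-- `θ^m`: the largest minimizer of `W̲(·, q*)` over `Θ`. -/
def IsThetaM (θm : ℝ) : Prop :=
  θm ∈ E.Θ ∧ (∀ θ' ∈ E.Θ, E.Wl Mo.qstar θm ≤ E.Wl Mo.qstar θ') ∧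
    ∀ θ ∈ E.Θ, (∀ θ' ∈ E.Θ, E.Wl Mo.qstar θ ≤ E.Wl Mo.qstar θ') → θ ≤ θm

/-- The conjectured demand `D*` as an element of `𝒟`. -/
def DstarDemand : Demand E where
  P := Mo.Pstar
  D := Mo.Dstar
  P_anti := Mo.Pstar_anti
  P_cont := Mo.Pstar_cont
  P_ge := Mo.Pstar_ge
  P0 := Mo.Pstar0
  D_inv := Mo.Dstar_inv
  D_high := Mo.Dstar_high
  D_low := Mo.Dstar_low
  D_lt := Mo.Dstar_lt

/-- Expected welfare `W((q,u); V*, F*)` of a quantity mechanism under the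
conjectured model. -/
def WStar (q u : ℝ → ℝ) : ℝ :=
  ∫ θ in E.θl..E.θu, (Mo.Vstar (q θ) - θ * q θ - u θ) * Mo.fstar θ

/-- Expected welfare `W̃((p,t); D*, F*)` of a price regulation under the
conjectured model. -/
def WtStar (p : ℝ → ℝ) (t : ℝ → Demand E → ℝ) : ℝ :=
  ∫ θ in E.θl..E.θu, E.wt p t θ Mo.DstarDemand * Mo.fstar θ

/-- A robustly optimal price regulation: in the price short list, and maximizing
expected welfare under the conjectured model over the price short list. -/
def RobustlyOptimalPR (p : ℝ → ℝ) (t : ℝ → Demand E → ℝ) : Prop :=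
  E.PriceShortList p t ∧
    ∀ (p' : ℝ → ℝ) (t' : ℝ → Demand E → ℝ), E.PriceShortList p' t' →
      Mo.WtStar p' t' ≤ Mo.WtStar p t

/-- A Baron–Myerson-with-price-cap regulation. -/
def IsBMPriceCap (p : ℝ → ℝ) (t : ℝ → Demand E → ℝ) : Prop :=
  E.IsAdmissiblePR p t ∧
  (∀ θ ∈ E.Θ, p θ = min (Mo.zstar θ) E.θu) ∧
  (∀ θ ∈ E.Θ, ∀ D : Demand E,
    E.rent p t θ D = E.rent p t E.θu D + ∫ y in θ..E.θu, D.D (p y)) ∧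
  (∀ D : Demand E, D ≠ E.DlDemand → D ≠ Mo.DstarDemand →
    0 ≤ E.rent p t E.θu D ∧
      E.rent p t E.θu D ≤ D.V (D.D E.θu) - E.θu * D.D E.θu - E.Gstar) ∧
  E.rent p t E.θu E.DlDemand = 0 ∧ E.rent p t E.θu Mo.DstarDemand = 0

end Model

theorem Env.ql_spec (E : Env) : E.ql ∈ Icc (0:ℝ) E.qbar ∧ E.Pl E.ql = E.θu := by
  refine E.Dl_inv E.θu ?_ E.Pl0.le
  by_contra h
  push Not at h
  have := E.Dl_low E.θl (E.θlu.trans h)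
  exact absurd E.Dl_lt (by rw [this]; exact lt_irrefl _)

theorem Env.cont_intervalIntegrable (E : Env) {P : ℝ → ℝ} (hP : ContinuousOn P (Icc 0 E.qbar))
    {a b : ℝ} (ha : a ∈ Icc (0:ℝ) E.qbar) (hb : b ∈ Icc (0:ℝ) E.qbar) :
    IntervalIntegrable P volume a b := by
  apply ContinuousOn.intervalIntegrable
  exact hP.mono (uIcc_subset_Icc ha hb)

theorem Env.surplus_lt (E : Env) {x : ℝ} (hx : x ∈ Icc (0:ℝ) E.qbar) (hne : x ≠ E.ql) :
    E.Vl x - E.θu * x < E.Gstar := by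
  obtain ⟨hq, hP⟩ := E.ql_spec
  have h0 : (0:ℝ) ∈ Icc (0:ℝ) E.qbar := ⟨le_refl _, E.qbar_pos.le⟩
  have i1 := E.cont_intervalIntegrable E.Pl_cont h0 hx
  have i2 := E.cont_intervalIntegrable E.Pl_cont h0 hq
  have i3 := E.cont_intervalIntegrable E.Pl_cont hx hq
  have hadd := intervalIntegral.integral_add_adjacent_intervals i1 i3
  unfold Env.Gstar Env.Vl
  have key : 0 < ∫ s in x..E.ql, (E.Pl s - E.θu) := by
    rcases lt_or_gt_of_ne hne with h | h
    · apply intervalIntegral.intervalIntegral_pos_of_pos_on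
        (i3.sub intervalIntegrable_const) _ h
      intro s hs
      have := E.Pl_anti ⟨hx.1.trans hs.1.le, hs.2.le.trans hq.2⟩ hq hs.2
      linarith
    · rw [intervalIntegral.integral_symm, ← intervalIntegral.integral_neg]
      apply intervalIntegral.intervalIntegral_pos_of_pos_on
        (i3.sub intervalIntegrable_const).symm.neg _ h
      intro s hs
      have := E.Pl_anti hq ⟨hq.1.trans hs.1.le, hs.2.le.trans hx.2⟩ hs.1
      simp only [Pi.neg_apply]
      linarith
  rw [intervalIntegral.integral_sub i3 intervalIntegrable_const,
    intervalIntegral.integral_const, smul_eq_mul] at key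
  linarith

theorem Env.Gstar_pos (E : Env) : 0 < E.Gstar := by
  have h := E.surplus_lt (x := 0) ⟨le_refl _, E.qbar_pos.le⟩ (by
    intro h
    have := E.ql_spec.2
    rw [← h] at this
    exact absurd E.Pl0 (by rw [this]; exact lt_irrefl _))
  simpa [Env.Vl] using h

theorem Env.isValue_Vl (E : Env) : E.IsValue E.Vl :=
  ⟨E.Pl, E.Pl_anti, E.Pl_cont, fun _ _ => le_refl _, fun _ => rfl⟩

theorem Env.isTech_dirac (E : Env) : E.IsTech (Measure.dirac E.θu) := by
  refine ⟨inferInstance, ?_⟩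
  rw [Measure.dirac_apply]
  simp [Env.Θ, E.θlu.le]

theorem Env.Gstar_le_const (E : Env) :
    E.Gstar ≤ E.G (fun _ => E.ql) (fun θ => (E.θu - θ) * E.ql) := by
  obtain ⟨hq, -⟩ := E.ql_spec
  apply le_csInf
  · exact ⟨_, _, _, E.isValue_Vl, E.isTech_dirac, rfl⟩
  · rintro w ⟨V, μ, ⟨P, hPa, hPc, hPge, hV⟩, ⟨hμ, -⟩, rfl⟩
    have h0 : (0:ℝ) ∈ Icc (0:ℝ) E.qbar := ⟨le_refl _, E.qbar_pos.le⟩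
    have hfun : (fun θ : ℝ => V E.ql - θ * E.ql - (E.θu - θ) * E.ql)
        = fun _ => V E.ql - E.θu * E.ql := by
      funext θ; ring
    unfold Env.W
    rw [hfun, integral_const]
    simp only [probReal_univ, one_smul]
    have : E.Vl E.ql ≤ V E.ql := by
      rw [hV]
      exact intervalIntegral.integral_mono_on hq.1 (E.cont_intervalIntegrable E.Pl_cont h0 hq)
        (E.cont_intervalIntegrable hPc h0 hq) (fun s hs => hPge s ⟨hs.1, hs.2.trans hq.2⟩)
    unfold Env.Gstar
    linarith

theorem Env.isMech_const (E : Env) :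
    E.IsMech (fun _ => E.ql) (fun θ => (E.θu - θ) * E.ql) := by
  refine ⟨⟨fun _ _ _ _ _ => le_refl _, fun _ _ => E.ql_spec.1⟩, by simp, fun θ _ => by simp⟩

/-- Observation 1 (quantity bound): any short-list mechanism procures at least `q_ℓ`
from every type, with equality at `θu`. -/
theorem shortList_quantity_bound (E : Env) (q u : ℝ → ℝ) (hSL : E.ShortList q u) :
    (∀ θ ∈ E.Θ, E.ql ≤ q θ) ∧ q E.θu = E.ql := by
  obtain ⟨⟨⟨hanti, hrange⟩, hu, -⟩, hmax⟩ := hSL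
  have hθu : E.θu ∈ E.Θ := ⟨E.θlu.le, le_refl _⟩
  have hG : E.Gstar ≤ E.G q u := E.Gstar_le_const.trans (hmax _ _ E.isMech_const)
  have hpos := E.Gstar_pos
  have hle : E.G q u ≤ E.W q u E.Vl (Measure.dirac E.θu) := by
    unfold Env.G at hG ⊢
    refine csInf_le ?_ ⟨_, _, E.isValue_Vl, E.isTech_dirac, rfl⟩
    by_contra hb
    rw [Real.sInf_of_not_bddBelow hb] at hG
    linarith
  have hW : E.W q u E.Vl (Measure.dirac E.θu)
      = E.Vl (q E.θu) - E.θu * q E.θu - u E.θu := by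
    unfold Env.W
    rw [integral_dirac]
  have heq : q E.θu = E.ql := by
    by_contra hne
    have := E.surplus_lt (hrange _ hθu) hne
    linarith
  refine ⟨fun θ hθ => ?_, heq⟩
  rw [← heq]
  exact hanti hθ hθu hθ.2
end
end

section
/- If θ^m < θ̄, then q*(θ^m) ≥ D̲(θ^m). If, in addition, θ^m > θ̲, then q*(θ^m) = D̲(θ^m). -/
open MeasureTheory Set

noncomputable section

/-- Demand values lie in `[0, c]`. -/
theorem aux_mem {c : ℝ} {P D : ℝ → ℝ} (hc : 0 < c)
    (hinv : ∀ p, P c ≤ p → p ≤ P 0 → D p ∈ Icc (0:ℝ) c ∧ P (D p) = p)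
    (hhigh : ∀ p, P 0 < p → D p = 0) (hlow : ∀ p, p < P c → D p = c) (p : ℝ) :
    D p ∈ Icc (0:ℝ) c := by
  by_cases h1 : P 0 < p
  · rw [hhigh p h1]; exact ⟨le_refl _, hc.le⟩
  by_cases h2 : p < P c
  · rw [hlow p h2]; exact ⟨hc.le, le_refl _⟩
  exact (hinv p (not_lt.1 h2) (not_lt.1 h1)).1

/-- A price with demand below capacity is above the inverse demand at capacity. -/
theorem aux_gt {c t : ℝ} {P D : ℝ → ℝ} (hc : 0 < c) (hP : StrictAntiOn P (Icc 0 c))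
    (hinv : ∀ p, P c ≤ p → p ≤ P 0 → D p ∈ Icc (0:ℝ) c ∧ P (D p) = p)
    (hlow : ∀ p, p < P c → D p = c) (ht : D t < c) : P c < t := by
  by_contra h
  rcases (not_lt.1 h).lt_or_eq with h | h
  · exact ht.ne (hlow t h)
  · have h0 : P c ≤ P 0 := hP.antitoneOn ⟨le_refl _, hc.le⟩ ⟨hc.le, le_refl _⟩ hc.le
    obtain ⟨hm, he⟩ := hinv t h.ge (h.trans_le h0)
    have := hP hm ⟨hc.le, le_refl _⟩ ht
    linarith

/-- Demand is antitone on prices above the inverse demand at capacity. -/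
theorem aux_anti {c p p' : ℝ} {P D : ℝ → ℝ} (hc : 0 < c) (hP : StrictAntiOn P (Icc 0 c))
    (hinv : ∀ p, P c ≤ p → p ≤ P 0 → D p ∈ Icc (0:ℝ) c ∧ P (D p) = p)
    (hhigh : ∀ p, P 0 < p → D p = 0) (hlow : ∀ p, p < P c → D p = c)
    (hp : P c ≤ p) (hpp : p ≤ p') : D p' ≤ D p := by
  by_cases h1 : P 0 < p'
  · rw [hhigh p' h1]; exact (aux_mem hc hinv hhigh hlow p).1
  · have h1 := not_lt.1 h1
    obtain ⟨a, ha⟩ := hinv p hp (hpp.trans h1)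
    obtain ⟨b, hb⟩ := hinv p' (hp.trans hpp) h1
    by_contra h
    have := hP a b (not_le.1 h)
    linarith

/-- Integral bounds for an inverse demand. -/
theorem aux_int (E : Env) {a b : ℝ} (ha : 0 ≤ a) (hab : a ≤ b) (hb : b ≤ E.qbar) :
    E.Pl b * (b - a) ≤ E.Vl b - E.Vl a ∧ E.Vl b - E.Vl a ≤ E.Pl a * (b - a) := by
  have hI : ∀ x y, 0 ≤ x → x ≤ y → y ≤ E.qbar → IntervalIntegrable E.Pl volume x y := by
    intro x y hx hxy hy
    apply ContinuousOn.intervalIntegrable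
    rw [uIcc_of_le hxy]
    exact E.Pl_cont.mono (Icc_subset_Icc hx hy)
  have hab' := hI a b ha hab hb
  have e : E.Vl b - E.Vl a = ∫ s in a..b, E.Pl s := by
    unfold Env.Vl
    exact intervalIntegral.integral_interval_sub_left (hI 0 b le_rfl (ha.trans hab) hb)
      (hI 0 a le_rfl ha (hab.trans hb))
  rw [e]
  constructor
  · have := intervalIntegral.integral_mono_on (f := fun _ => E.Pl b) (g := E.Pl) hab
      (by simp) hab' (fun x hx => E.Pl_anti.antitoneOn ⟨ha.trans hx.1, hx.2.trans hb⟩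
        ⟨ha.trans hab, hb⟩ hx.2)
    simp at this
    linarith
  · have := intervalIntegral.integral_mono_on (g := fun _ => E.Pl a) (f := E.Pl) hab
      hab' (by simp) (fun x hx => E.Pl_anti.antitoneOn ⟨ha, hab.trans hb⟩
        ⟨ha.trans hx.1, hx.2.trans hb⟩ hx.1)
    simp at this
    linarith

/-- Welfare difference and bounds for a schedule. -/
theorem aux_W (E : Env) {q : ℝ → ℝ} (hq : E.IsSchedule q) {s t : ℝ} (hs : E.θl ≤ s)
    (hst : s ≤ t) (ht : t ≤ E.θu) :
    ∃ I, E.Wl q t - E.Wl q s = E.Vl (q t) - E.Vl (q s) - t * q t + s * q s + I ∧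
      q t * (t - s) ≤ I ∧ I ≤ q s * (t - s) := by
  have hI : ∀ x y, E.θl ≤ x → x ≤ y → y ≤ E.θu → IntervalIntegrable q volume x y := by
    intro x y hx hxy hy
    apply AntitoneOn.intervalIntegrable
    rw [uIcc_of_le hxy]
    exact hq.1.mono (Icc_subset_Icc hx hy)
  have hst' := hI s t hs hst ht
  have e := intervalIntegral.integral_add_adjacent_intervals hst'
    (hI t E.θu (hs.trans hst) ht le_rfl)
  refine ⟨∫ y in s..t, q y, ?_, ?_, ?_⟩
  · unfold Env.Wl
    linarith
  · have := intervalIntegral.integral_mono_on (f := fun _ => q t) (g := q) hst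
      (by simp) hst' (fun x hx => hq.1 ⟨hs.trans hx.1, hx.2.trans ht⟩
        ⟨hs.trans hst, ht⟩ hx.2)
    simp at this
    linarith
  · have := intervalIntegral.integral_mono_on (g := fun _ => q s) (f := q) hst
      hst' (by simp) (fun x hx => hq.1 ⟨hs, hst.trans ht⟩
        ⟨hs.trans hx.1, hx.2.trans ht⟩ hx.1)
    simp at this
    linarith

/-- Lemma (bound at θ^m): if `θ^m < θu`, then `q*(θ^m) ≥ D̲(θ^m)`; if in addition
`θ^m > θl`, then `q*(θ^m) = D̲(θ^m)`. -/
theorem qstar_at_thetaM (E : Env) (Mo : Model E) (θm : ℝ) (hθm : Mo.IsThetaM θm) :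
    (θm < E.θu → E.Dl θm ≤ Mo.qstar θm) ∧
      (θm < E.θu → E.θl < θm → Mo.qstar θm = E.Dl θm) := by
  have hc := E.qbar_pos
  obtain ⟨⟨hl, hu⟩, hmin, hmax⟩ := hθm
  have hPl : E.Pl E.qbar < E.θl := aux_gt hc E.Pl_anti E.Dl_inv E.Dl_low E.Dl_lt
  have hPs : Mo.Pstar E.qbar < E.θl :=
    aux_gt hc Mo.Pstar_anti Mo.Dstar_inv Mo.Dstar_low Mo.Dstar_lt
  have hlΘ : E.θl ∈ E.Θ := ⟨le_rfl, E.θlu.le⟩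
  have hz : ∀ θ ∈ E.Θ, E.θl ≤ Mo.zstar θ := by
    intro θ hθ
    have h := Mo.zstar_mono.monotoneOn hlΘ hθ hθ.1
    simp only [Mo.Fstar_l] at h
    unfold Model.zstar
    simpa using h
  have hlmem : E.ql ∈ Icc (0:ℝ) E.qbar := aux_mem hc E.Dl_inv E.Dl_high E.Dl_low _
  have hbm : ∀ θ, Mo.qBM θ ∈ Icc (0:ℝ) E.qbar := fun θ =>
    aux_mem hc Mo.Dstar_inv Mo.Dstar_high Mo.Dstar_low _
  have hq : E.IsSchedule Mo.qstar := by
    constructor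
    · intro a ha b hb hab
      apply max_le_max _ le_rfl
      change Mo.Dstar (Mo.zstar b) ≤ Mo.Dstar (Mo.zstar a)
      exact aux_anti hc Mo.Pstar_anti Mo.Dstar_inv Mo.Dstar_high Mo.Dstar_low
        (hPs.le.trans (hz a ha)) (Mo.zstar_mono.monotoneOn ha hb hab)
    · intro θ _
      exact ⟨le_max_of_le_left (hbm θ).1, max_le (hbm θ).2 hlmem.2⟩
  obtain ⟨hDm, hDe⟩ := E.Dl_inv θm (hPl.le.trans hl) (hu.trans E.Pl0.le)
  have hqm := hq.2 θm ⟨hl, hu⟩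
  have part1 : θm < E.θu → E.Dl θm ≤ Mo.qstar θm := by
    intro hlt
    by_contra h
    have h1 := E.Pl_anti hqm hDm (not_le.1 h)
    rw [hDe] at h1
    obtain ⟨t, ht1, ht2⟩ := exists_between (lt_min h1 hlt)
    have ht3 := ht2.le.trans (min_le_left _ _)
    have ht4 := ht2.le.trans (min_le_right _ _)
    have htΘ : t ∈ E.Θ := ⟨hl.trans ht1.le, ht4⟩
    obtain ⟨I, e, _, hI⟩ := aux_W E hq hl ht1.le ht4
    have hqq := hq.1 ⟨hl, hu⟩ htΘ ht1.le
    have hV := (aux_int E (hq.2 t htΘ).1 hqq hqm.2).1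
    have hm := mul_le_mul_of_nonneg_right ht3 (sub_nonneg.2 hqq)
    have hle : E.Wl Mo.qstar t ≤ E.Wl Mo.qstar θm := by nlinarith
    exact absurd (hmax t htΘ (fun θ' h' => hle.trans (hmin θ' h'))) (not_le.2 ht1)
  refine ⟨part1, fun hlt hgt => le_antisymm ?_ (part1 hlt)⟩
  by_contra h
  have h := not_le.1 h
  have h1 := E.Pl_anti hDm hqm h
  rw [hDe] at h1
  obtain ⟨t, ht1, ht2⟩ := exists_between (max_lt h1 hgt)
  have ht3 := (le_max_left _ _).trans_lt ht1
  have ht4 := (le_max_right _ _).trans ht1.le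
  have htΘ : t ∈ E.Θ := ⟨ht4, ht2.le.trans hu⟩
  obtain ⟨I, e, hI, _⟩ := aux_W E hq ht4 ht2.le hu
  have hql : E.ql ≤ E.Dl θm :=
    aux_anti hc E.Pl_anti E.Dl_inv E.Dl_high E.Dl_low (hPl.le.trans hl) hu
  have hB : E.ql < Mo.qBM θm := by
    rcases lt_max_iff.1 (hql.trans_lt h) with h | h
    · exact h
    · exact absurd h (lt_irrefl _)
  have hqe : Mo.qstar θm = Mo.qBM θm := max_eq_left hB.le
  have hz0 : Mo.zstar θm ≤ Mo.Pstar 0 := by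
    by_contra h'
    have : Mo.qBM θm = 0 := Mo.Dstar_high _ (not_le.1 h')
    linarith [hlmem.1]
  have hzz : Mo.zstar t < Mo.zstar θm := Mo.zstar_mono htΘ ⟨hl, hu⟩ ht2
  obtain ⟨ma, ea⟩ := Mo.Dstar_inv (Mo.zstar t) (hPs.le.trans (hz t htΘ)) (hzz.le.trans hz0)
  obtain ⟨mb, eb⟩ := Mo.Dstar_inv (Mo.zstar θm) (hPs.le.trans (hz θm ⟨hl, hu⟩)) hz0
  have hstrict : Mo.qBM θm < Mo.qBM t := by
    by_contra h'
    have := Mo.Pstar_anti.antitoneOn ma mb (not_lt.1 h')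
    rw [ea, eb] at this
    linarith
  have hqq : Mo.qstar θm < Mo.qstar t := by
    rw [hqe]; exact hstrict.trans_le (le_max_left _ _)
  have hV := (aux_int E hqm.1 hqq.le (hq.2 t htΘ).2).2
  have hm := mul_lt_mul_of_pos_right ht3 (sub_pos.2 hqq)
  have := hmin t htΘ
  nlinarith
end
end
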